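/- arXiv:1002.1471 — 8 statements merged into one kernel-verified Lean document; each statement's English description precedes it below -/
import Mathlib

section
/- Let n ≥ 2 be an integer, R ∈ (0,∞], and let s : [0,R) → ℝ be continuous with s(ρ) ≥ 0 for all ρ. Suppose τ : (0,R) → ℝ is differentiable, satisfies the Raychaudhuri equation τ'(r) = −τ(r)²/(n−1) − s(r) for all r ∈ (0,R), and r²·τ(r) → 0 as r → 0⁺. Then for every r ∈ (0,R) one has r²·τ(r) ≤ (n−1)·r − ∫₀^r ρ²·s(ρ) dρ. -/
open Set Filter Topology MeasureTheory intervalIntegral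

/-- Under the Raychaudhuri equation with nonnegative shear term `s`,
and the vertex condition `r² τ(r) → 0`, one has
`r² τ(r) ≤ (n-1) r - ∫₀^r ρ² s(ρ) dρ` on `(0,R)`, where `R ∈ (0,∞]`. -/
theorem raychaudhuri_upper_bound
    (n : ℕ) (hn : 2 ≤ n) (R : EReal) (hR : 0 < R) (s τ : ℝ → ℝ)
    (hs_cont : ContinuousOn s {ρ : ℝ | 0 ≤ ρ ∧ (ρ : EReal) < R})
    (hs_nonneg : ∀ ρ : ℝ, 0 ≤ ρ → (ρ : EReal) < R → 0 ≤ s ρ)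
    (hτ : ∀ r : ℝ, 0 < r → (r : EReal) < R →
      HasDerivAt τ (-(τ r) ^ 2 / ((n : ℝ) - 1) - s r) r)
    (hlim : Tendsto (fun r : ℝ => r ^ 2 * τ r) (𝓝[>] 0) (𝓝 0)) :
    ∀ r : ℝ, 0 < r → (r : EReal) < R →
      r ^ 2 * τ r ≤ ((n : ℝ) - 1) * r - ∫ ρ in (0:ℝ)..r, ρ ^ 2 * s ρ := by
  intro r hr hrR
  have hc : (0 : ℝ) < (n : ℝ) - 1 := by
    have : (2 : ℝ) ≤ n := by exact_mod_cast hn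
    linarith
  have hlt : ∀ x : ℝ, x ≤ r → (x : EReal) < R := fun x hx =>
    lt_of_le_of_lt (EReal.coe_le_coe_iff.2 hx) hrR
  have hf : ContinuousOn (fun ρ : ℝ => ρ ^ 2 * s ρ) (Icc 0 r) :=
    (continuousOn_id.pow 2).mul (hs_cont.mono fun x hx => ⟨hx.1, hlt x hx.2⟩)
  have hF : ContinuousOn (fun x : ℝ => ∫ ρ in (0:ℝ)..x, ρ ^ 2 * s ρ) (Icc 0 r) := by
    have h := continuousOn_primitive_interval (μ := volume) (a := 0) (b := r)
      (f := fun ρ : ℝ => ρ ^ 2 * s ρ) (by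
        rw [uIcc_of_le hr.le]
        exact hf.integrableOn_Icc)
    rwa [uIcc_of_le hr.le] at h
  set g : ℝ → ℝ := fun x =>
    x ^ 2 * τ x - ((n : ℝ) - 1) * x + ∫ ρ in (0:ℝ)..x, ρ ^ 2 * s ρ with hg
  have hg_cont : ContinuousOn g (Ioc 0 r) := by
    have hτc : ContinuousOn τ (Ioc 0 r) := fun x hx =>
      (hτ x hx.1 (hlt x hx.2)).continuousAt.continuousWithinAt
    exact (((continuousOn_id.pow 2).mul hτc).sub (continuousOn_const.mul continuousOn_id)).add
      (hF.mono Ioc_subset_Icc_self)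
  have hg_deriv : ∀ x ∈ Ioo 0 r, HasDerivAt g
      (2 * x * τ x + x ^ 2 * (-(τ x) ^ 2 / ((n : ℝ) - 1) - s x) - ((n : ℝ) - 1)
        + x ^ 2 * s x) x := by
    intro x hx
    have hint : HasDerivAt (fun u : ℝ => ∫ ρ in (0:ℝ)..u, ρ ^ 2 * s ρ) (x ^ 2 * s x) x :=
      integral_hasDerivAt_right
        ((hf.mono (Icc_subset_Icc_right hx.2.le)).intervalIntegrable_of_Icc hx.1.le)
        ((hf.mono Ioo_subset_Icc_self).stronglyMeasurableAtFilter isOpen_Ioo x hx)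
        (hf.continuousAt (Icc_mem_nhds hx.1 hx.2))
    have h2 : HasDerivAt (fun u : ℝ => u ^ 2) (2 * x) x := by simpa using hasDerivAt_pow 2 x
    have h3 : HasDerivAt (fun u : ℝ => ((n : ℝ) - 1) * u) ((n : ℝ) - 1) x := by
      simpa using (hasDerivAt_id x).const_mul ((n : ℝ) - 1)
    exact ((h2.mul (hτ x hx.1 (hlt x hx.2.le))).sub h3).add hint
  have hanti : AntitoneOn g (Ioc 0 r) := by
    refine antitoneOn_of_deriv_nonpos (convex_Ioc 0 r) hg_cont ?_ ?_ <;> rw [interior_Ioc]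
    · exact fun x hx => (hg_deriv x hx).differentiableAt.differentiableWithinAt
    · intro x hx
      rw [(hg_deriv x hx).deriv]
      have hsq : 2 * x * τ x + x ^ 2 * (-(τ x) ^ 2 / ((n : ℝ) - 1) - s x) - ((n : ℝ) - 1)
          + x ^ 2 * s x = -((x * τ x - ((n : ℝ) - 1)) ^ 2 / ((n : ℝ) - 1)) := by
        field_simp
        ring
      rw [hsq]
      exact neg_nonpos.2 (by positivity)
  have hg_lim : Tendsto g (𝓝[>] 0) (𝓝 0) := by
    have hF0 : Tendsto (fun x : ℝ => ∫ ρ in (0:ℝ)..x, ρ ^ 2 * s ρ) (𝓝[>] 0) (𝓝 0) := by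
      have h := (hF 0 (left_mem_Icc.2 hr.le)).tendsto
      rw [integral_same] at h
      rw [← nhdsWithin_Ioc_eq_nhdsGT hr]
      exact h.mono_left (nhdsWithin_mono _ Ioc_subset_Icc_self)
    have hlin : Tendsto (fun x : ℝ => ((n : ℝ) - 1) * x) (𝓝[>] 0) (𝓝 0) := by
      have h : Continuous fun x : ℝ => ((n : ℝ) - 1) * x := by fun_prop
      simpa using (h.tendsto 0).mono_left nhdsWithin_le_nhds
    simpa using (hlim.sub hlin).add hF0
  have hg_nonpos : g r ≤ 0 := by
    refine ge_of_tendsto hg_lim ?_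
    filter_upwards [Ioc_mem_nhdsGT hr] with x hx
    exact hanti hx (right_mem_Ioc.2 hr) hx.2
  simp only [hg] at hg_nonpos
  linarith
end

section
/- Let n ≥ 2 be an integer, R ∈ (0,∞], and let s : [0,R) → ℝ be continuous with s(ρ) ≥ 0 for all ρ. Suppose τ : (0,R) → ℝ is differentiable, satisfies the Raychaudhuri equation τ'(r) = −τ(r)²/(n−1) − s(r) for all r ∈ (0,R), and r²·τ(r) → 0 as r → 0⁺. Then τ(r) ≤ (n−1)/r for every r ∈ (0,R). -/
open Set Filter Topology MeasureTheory intervalIntegral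

/-- Under the Raychaudhuri equation with nonnegative shear term `s`,
and the vertex condition `r² τ(r) → 0`, one has `τ(r) ≤ (n-1)/r` on `(0,R)`,
where `R ∈ (0,∞]`. -/
theorem raychaudhuri_flat_cone_comparison
    (n : ℕ) (hn : 2 ≤ n) (R : EReal) (hR : 0 < R) (s τ : ℝ → ℝ)
    (hs_cont : ContinuousOn s {ρ : ℝ | 0 ≤ ρ ∧ (ρ : EReal) < R})
    (hs_nonneg : ∀ ρ : ℝ, 0 ≤ ρ → (ρ : EReal) < R → 0 ≤ s ρ)
    (hτ : ∀ r : ℝ, 0 < r → (r : EReal) < R →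
      HasDerivAt τ (-(τ r) ^ 2 / ((n : ℝ) - 1) - s r) r)
    (hlim : Tendsto (fun r : ℝ => r ^ 2 * τ r) (𝓝[>] 0) (𝓝 0)) :
    ∀ r : ℝ, 0 < r → (r : EReal) < R → τ r ≤ ((n : ℝ) - 1) / r := by
  intro r hr hrR
  have hn1 : (0 : ℝ) < (n : ℝ) - 1 := by
    have : (2 : ℝ) ≤ n := by exact_mod_cast hn
    linarith
  have hlt : ∀ x ∈ Ioc 0 r, (x : EReal) < R := fun x hx =>
    lt_of_le_of_lt (EReal.coe_le_coe_iff.2 hx.2) hrR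
  set g : ℝ → ℝ := fun x => x ^ 2 * τ x - ((n : ℝ) - 1) * x with hg
  have hderiv : ∀ x ∈ Ioc 0 r, HasDerivAt g
      (-((x * τ x - ((n : ℝ) - 1)) ^ 2 / ((n : ℝ) - 1)) - x ^ 2 * s x) x := by
    intro x hx
    refine (((hasDerivAt_pow 2 x).mul (hτ x hx.1 (hlt x hx))).sub
      ((hasDerivAt_id x).const_mul ((n : ℝ) - 1))).congr_deriv ?_
    field_simp
    push_cast
    ring
  have hanti : AntitoneOn g (Ioc 0 r) := by
    refine antitoneOn_of_hasDerivWithinAt_nonpos (convex_Ioc 0 r)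
      (fun x hx => (hderiv x hx).continuousAt.continuousWithinAt)
      (fun x hx => (hderiv x (interior_subset hx)).hasDerivWithinAt) (fun x hx => ?_)
    have hx' := interior_subset hx
    have h₁ : 0 ≤ (x * τ x - ((n : ℝ) - 1)) ^ 2 / ((n : ℝ) - 1) := by positivity
    have h₂ := mul_nonneg (sq_nonneg x) (hs_nonneg x hx'.1.le (hlt x hx'))
    linarith
  have hg0 : Tendsto g (𝓝[>] 0) (𝓝 0) := by
    have hlin : Tendsto (fun x : ℝ => ((n : ℝ) - 1) * x) (𝓝[>] 0) (𝓝 0) := by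
      have hc : Continuous fun x : ℝ => ((n : ℝ) - 1) * x := by fun_prop
      simpa using (hc.tendsto 0).mono_left nhdsWithin_le_nhds
    simpa using hlim.sub hlin
  have hgr : g r ≤ 0 := by
    refine ge_of_tendsto hg0 ?_
    filter_upwards [Ioc_mem_nhdsGT hr] with x hx
    exact hanti hx ⟨hr, le_rfl⟩ hx.2
  rw [le_div_iff₀ hr]
  refine le_of_mul_le_mul_right ?_ hr
  simp only [hg] at hgr
  linarith
end

section
/- Let n ≥ 2 be an integer, R ∈ (0,∞], and let s : [0,R) → ℝ be continuous with s(ρ) ≥ 0 for all ρ. Suppose τ : (0,R) → ℝ is differentiable, satisfies the Raychaudhuri equation τ'(r) = −τ(r)²/(n−1) − s(r) for all r ∈ (0,R), and r²·τ(r) → 0 as r → 0⁺. If there exists r₁ ∈ (0,R) with ∫₀^{r₁} ρ²·s(ρ) dρ ≥ (n−1)·r₁, then τ(r₁) ≤ 0; in particular τ is not everywhere positive on (0, r₁], so if τ is continuous and positive near 0 it has a zero in (0, r₁]. -/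
open Set Filter Topology MeasureTheory intervalIntegral

/-- A solution of the Raychaudhuri equation `τ' = -τ² / m - s` on `(0, b]` with `r² τ(r) → 0`
at the vertex satisfies `b² τ(b) ≤ m b - ∫₀ᵇ ρ² s(ρ) dρ`. -/
theorem mul_sq_le_of_raychaudhuri {m b : ℝ} (hm : 0 < m) (hb : 0 < b) {s τ : ℝ → ℝ}
    (hs : ContinuousOn s (Icc 0 b))
    (hτ : ∀ r ∈ Ioc 0 b, HasDerivAt τ (-(τ r) ^ 2 / m - s r) r)
    (hlim : Tendsto (fun r : ℝ => r ^ 2 * τ r) (𝓝[>] 0) (𝓝 0)) :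
    b ^ 2 * τ b ≤ m * b - ∫ ρ in (0 : ℝ)..b, ρ ^ 2 * s ρ := by
  have hf : ContinuousOn (fun ρ => ρ ^ 2 * s ρ) (Icc 0 b) := by fun_prop
  have hf_int : IntervalIntegrable (fun ρ => ρ ^ 2 * s ρ) volume 0 b :=
    hf.intervalIntegrable_of_Icc hb.le
  have hcont_sq : ContinuousOn (fun r => r ^ 2 * τ r) (Icc 0 b) := by
    intro x hx
    rcases hx.1.eq_or_lt with rfl | hx0
    · refine ContinuousWithinAt.mono (t := Ici 0) ?_ fun y hy => hy.1
      rw [← Ioi_insert, continuousWithinAt_insert_self]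
      simpa [ContinuousWithinAt] using hlim
    · exact ((continuousAt_id.pow 2).mul (hτ x ⟨hx0, hx.2⟩).continuousAt).continuousWithinAt
  have hcont_int : ContinuousOn (fun r => ∫ ρ in (0 : ℝ)..r, ρ ^ 2 * s ρ) (Icc 0 b) := by
    have h := continuousOn_primitive_interval (μ := volume) (a := 0) (b := b)
      (f := fun ρ => ρ ^ 2 * s ρ) (by rw [uIcc_of_le hb.le]; exact hf.integrableOn_Icc)
    rwa [uIcc_of_le hb.le] at h
  have hanti : AntitoneOn
      (fun r => r ^ 2 * τ r - m * r + ∫ ρ in (0 : ℝ)..r, ρ ^ 2 * s ρ) (Icc 0 b) := by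
    refine antitoneOn_of_hasDerivWithinAt_nonpos (convex_Icc 0 b)
      (f' := fun r => -(r * τ r - m) ^ 2 / m)
      ((hcont_sq.sub (by fun_prop)).add hcont_int) ?_ ?_
    · intro x hx
      rw [interior_Icc] at hx
      have hfx : HasDerivAt (fun r => ∫ ρ in (0 : ℝ)..r, ρ ^ 2 * s ρ) (x ^ 2 * s x) x :=
        integral_hasDerivAt_right
          (hf_int.mono_set (by
            rw [uIcc_of_le hx.1.le, uIcc_of_le hb.le]
            exact Icc_subset_Icc_right hx.2.le))
          ((hf.mono Ioo_subset_Icc_self).stronglyMeasurableAtFilter isOpen_Ioo x hx)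
          (hf.continuousAt (Icc_mem_nhds hx.1 hx.2))
      have h := ((((hasDerivAt_id x).pow 2).mul (hτ x ⟨hx.1, hx.2.le⟩)).sub
        ((hasDerivAt_id x).const_mul m)).add hfx
      refine (h.congr_deriv ?_).hasDerivWithinAt
      simp only [id, Pi.pow_apply]
      field_simp
      ring
    · intro x _
      exact div_nonpos_of_nonpos_of_nonneg (neg_nonpos.2 (sq_nonneg _)) hm.le
  have h := hanti ⟨le_rfl, hb.le⟩ ⟨hb.le, le_rfl⟩ hb.le
  simp only [integral_same] at h
  linarith

/-- Under the Raychaudhuri equation with nonnegative shear term `s`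
and the vertex condition `r² τ(r) → 0`, if `∫₀^{r₁} ρ² s(ρ) dρ ≥ (n-1) r₁` for some
`r₁ ∈ (0,R)`, then `τ(r₁) ≤ 0`; in particular `τ` is not everywhere positive on
`(0,r₁]`, so if `τ` is continuous and positive near `0` it has a zero in `(0,r₁]`. -/
theorem raychaudhuri_trapped
    (n : ℕ) (hn : 2 ≤ n) (R : EReal) (hR : 0 < R) (s τ : ℝ → ℝ)
    (hs_cont : ContinuousOn s {ρ : ℝ | 0 ≤ ρ ∧ (ρ : EReal) < R})
    (hs_nonneg : ∀ ρ : ℝ, 0 ≤ ρ → (ρ : EReal) < R → 0 ≤ s ρ)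
    (hτ : ∀ r : ℝ, 0 < r → (r : EReal) < R →
      HasDerivAt τ (-(τ r) ^ 2 / ((n : ℝ) - 1) - s r) r)
    (hlim : Tendsto (fun r : ℝ => r ^ 2 * τ r) (𝓝[>] 0) (𝓝 0))
    (r₁ : ℝ) (hr₁ : 0 < r₁) (hr₁R : (r₁ : EReal) < R)
    (hint : ((n : ℝ) - 1) * r₁ ≤ ∫ ρ in (0:ℝ)..r₁, ρ ^ 2 * s ρ) :
    τ r₁ ≤ 0 ∧ ¬ (∀ r ∈ Ioc (0:ℝ) r₁, 0 < τ r) ∧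
      (ContinuousOn τ (Ioc (0:ℝ) r₁) → (∃ ε > 0, ∀ r ∈ Ioo (0:ℝ) ε, 0 < τ r) →
        ∃ r ∈ Ioc (0:ℝ) r₁, τ r = 0) := by
  have hm : (0 : ℝ) < (n : ℝ) - 1 := by
    have : (2 : ℝ) ≤ n := by exact_mod_cast hn
    linarith
  have hltR : ∀ x : ℝ, x ≤ r₁ → (x : EReal) < R := fun x hx =>
    lt_of_le_of_lt (by exact_mod_cast hx) hr₁R
  have hs_Icc : ContinuousOn s (Icc 0 r₁) :=
    hs_cont.mono fun x hx => ⟨hx.1, hltR x hx.2⟩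
  have hle := mul_sq_le_of_raychaudhuri hm hr₁ hs_Icc
    (fun r hr => hτ r hr.1 (hltR r hr.2)) hlim
  have hτ₁ : τ r₁ ≤ 0 := by
    have h : r₁ ^ 2 * τ r₁ ≤ 0 := by linarith
    exact nonpos_of_mul_nonpos_right h (by positivity)
  refine ⟨hτ₁, fun h => (h r₁ ⟨hr₁, le_rfl⟩).not_ge hτ₁, ?_⟩
  rintro hcont ⟨ε, hε, hpos⟩
  have ha : 0 < min (ε / 2) r₁ := lt_min (by linarith) hr₁
  have ha' : min (ε / 2) r₁ < ε := (min_le_left _ _).trans_lt (by linarith)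
  have hsub : Icc (min (ε / 2) r₁) r₁ ⊆ Ioc 0 r₁ := fun x hx => ⟨ha.trans_le hx.1, hx.2⟩
  obtain ⟨r, hr, hr0⟩ := intermediate_value_Icc' (min_le_right (ε / 2) r₁) (hcont.mono hsub)
    ⟨hτ₁, (hpos _ ⟨ha, ha'⟩).le⟩
  exact ⟨r, hsub hr, hr0⟩
end

section
/- Let n ≥ 2 be an integer, T > 0, and let s : (0,T] → ℝ be continuous. Suppose τ₁, τ₂ : (0,T] → (0,∞) are both differentiable, both satisfy the Raychaudhuri equation τᵢ'(r) = −τᵢ(r)²/(n−1) − s(r) for all r ∈ (0,T], and both satisfy τᵢ(r) − (n−1)/r → 0 as r → 0⁺. Then τ₁ = τ₂ on (0,T]. -/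
open Set Filter Topology

/-- Two positive solutions of the Raychaudhuri equation on `(0,T]`
with the same shear term `s`, both with `τᵢ(r) - (n-1)/r → 0` at the vertex,
coincide on `(0,T]`. -/
theorem raychaudhuri_uniqueness
    (n : ℕ) (hn : 2 ≤ n) (T : ℝ) (hT : 0 < T) (s τ₁ τ₂ : ℝ → ℝ)
    (hs_cont : ContinuousOn s (Ioc (0:ℝ) T))
    (hτ₁_pos : ∀ r ∈ Ioc (0:ℝ) T, 0 < τ₁ r)
    (hτ₂_pos : ∀ r ∈ Ioc (0:ℝ) T, 0 < τ₂ r)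
    (hτ₁ : ∀ r ∈ Ioc (0:ℝ) T,
      HasDerivAt τ₁ (-(τ₁ r) ^ 2 / ((n : ℝ) - 1) - s r) r)
    (hτ₂ : ∀ r ∈ Ioc (0:ℝ) T,
      HasDerivAt τ₂ (-(τ₂ r) ^ 2 / ((n : ℝ) - 1) - s r) r)
    (hlim₁ : Tendsto (fun r : ℝ => τ₁ r - ((n : ℝ) - 1) / r) (𝓝[>] 0) (𝓝 0))
    (hlim₂ : Tendsto (fun r : ℝ => τ₂ r - ((n : ℝ) - 1) / r) (𝓝[>] 0) (𝓝 0)) :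
    ∀ r ∈ Ioc (0:ℝ) T, τ₁ r = τ₂ r := by
  have hm : (0 : ℝ) < (n : ℝ) - 1 := by
    have : (2 : ℝ) ≤ n := by exact_mod_cast hn
    linarith
  have hderiv : ∀ r ∈ Ioc (0 : ℝ) T, HasDerivAt (fun x => (τ₁ x - τ₂ x) ^ 2)
      (-(2 * (τ₁ r - τ₂ r) ^ 2 * (τ₁ r + τ₂ r) / ((n : ℝ) - 1))) r := by
    intro r hr
    refine (((hτ₁ r hr).sub (hτ₂ r hr)).pow 2).congr_deriv ?_
    simp only [Pi.sub_apply]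
    field_simp
    ring
  have hanti : AntitoneOn (fun x => (τ₁ x - τ₂ x) ^ 2) (Ioc (0 : ℝ) T) := by
    refine antitoneOn_of_hasDerivWithinAt_nonpos (convex_Ioc 0 T)
      (fun r hr => (hderiv r hr).continuousAt.continuousWithinAt)
      (fun r hr => (hderiv r (interior_subset hr)).hasDerivWithinAt) (fun r hr => ?_)
    have h₁ := hτ₁_pos r (interior_subset hr)
    have h₂ := hτ₂_pos r (interior_subset hr)
    rw [neg_nonpos]
    positivity
  have hlim : Tendsto (fun x => (τ₁ x - τ₂ x) ^ 2) (𝓝[>] 0) (𝓝 0) := by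
    simpa using (hlim₁.sub hlim₂).pow 2
  intro r hr
  have hle : (τ₁ r - τ₂ r) ^ 2 ≤ 0 := by
    refine ge_of_tendsto hlim ?_
    filter_upwards [Ioc_mem_nhdsGT hr.1] with x hx
    exact hanti ⟨hx.1, hx.2.trans hr.2⟩ hr hx.2
  exact sub_eq_zero.mp (pow_eq_zero_iff two_ne_zero |>.mp (le_antisymm hle (sq_nonneg _)))
end

section
/- Let n ≥ 2 be an integer, T > 0, and let s : [0,T] → ℝ be continuous with s(ρ) ≥ 0 for all ρ. Then there exist T' ∈ (0,T] and a differentiable function τ : (0,T'] → (0,∞) satisfying the Raychaudhuri equation τ'(r) = −τ(r)²/(n−1) − s(r) for all r ∈ (0,T'] and such that (n−1)/r − τ(r) → 0 as r → 0⁺. -/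
open Set Filter Topology

/-- A second-order scalar linear equation `y'' = -q y` with continuous coefficient has a solution
near `0` with `y 0 = 0` and `y' 0 = 1`. -/
lemma exists_eventually_solution_linear_second_order {q : ℝ → ℝ} (hq : Continuous q) :
    ∃ y v : ℝ → ℝ, y 0 = 0 ∧ v 0 = 1 ∧
      ∀ᶠ t in 𝓝 (0 : ℝ), HasDerivAt y (v t) t ∧ HasDerivAt v (-q t * y t) t := by
  obtain ⟨M, hM⟩ := (isCompact_Icc (a := (-1 : ℝ)) (b := 1)).exists_bound_of_continuousOn
    hq.continuousOn
  have hM0 : 0 ≤ M := (norm_nonneg _).trans (hM 0 (by norm_num))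
  set ε : ℝ := 1 / (2 + M) with hε
  have hε0 : 0 < ε := by positivity
  have hε1 : ε ≤ 1 := by
    rw [hε, div_le_one (by positivity)]
    linarith
  have hqM : ∀ t ∈ Icc (-ε) ε, |q t| ≤ M := fun t ht =>
    hM t ⟨by linarith [ht.1], by linarith [ht.2]⟩
  let f : ℝ → ℝ × ℝ → ℝ × ℝ := fun t p => (p.2, -q t * p.1)
  have hf : IsPicardLindelof f (⟨0, by constructor <;> linarith⟩ : Icc (-ε) ε)
      ((0, 1) : ℝ × ℝ) 1 0 ⟨2 + M, by positivity⟩ ⟨1 + M, by positivity⟩ := by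
    constructor
    · intro t ht
      refine LipschitzOnWith.of_dist_le_mul fun p _ p' _ => ?_
      have h := hqM t ht
      have h1 : |p.1 - p'.1| ≤ dist p p' := by
        rw [← Real.dist_eq, Prod.dist_eq]; exact le_max_left _ _
      have h2 : |p.2 - p'.2| ≤ dist p p' := by
        rw [← Real.dist_eq, Prod.dist_eq]; exact le_max_right _ _
      have h0 : 0 ≤ dist p p' := dist_nonneg
      change dist (p.2, -q t * p.1) (p'.2, -q t * p'.1) ≤ (1 + M) * dist p p'
      rw [Prod.dist_eq]
      refine max_le ?_ ?_
      · rw [Real.dist_eq]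
        nlinarith
      · rw [Real.dist_eq, ← mul_sub, abs_mul, abs_neg]
        nlinarith [mul_le_mul h h1 (abs_nonneg _) hM0]
    · intro x _
      exact Continuous.continuousOn (by fun_prop)
    · intro t ht p hp
      have h := hqM t ht
      have hp' : dist p (0, 1) ≤ 1 := hp
      rw [Prod.dist_eq, max_le_iff, Real.dist_eq, Real.dist_eq] at hp'
      obtain ⟨h1, h2⟩ := hp'
      simp only [sub_zero] at h1
      rw [abs_le] at h2
      change ‖(p.2, -q t * p.1)‖ ≤ 2 + M
      rw [Prod.norm_def]
      refine max_le ?_ ?_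
      · rw [Real.norm_eq_abs, abs_le]
        constructor <;> linarith [h2.1, h2.2]
      · rw [Real.norm_eq_abs, abs_mul, abs_neg]
        nlinarith [mul_le_mul h h1 (abs_nonneg _) hM0]
    · change (2 + M) * max (ε - 0) (0 - -ε) ≤ 1 - 0
      simp only [sub_zero, zero_sub, neg_neg, max_self, hε]
      rw [mul_one_div_cancel (by positivity)]
  obtain ⟨α, h0, hα⟩ := hf.exists_eq_forall_mem_Icc_hasDerivWithinAt₀
  change α 0 = (0, 1) at h0
  refine ⟨fun t => (α t).1, fun t => (α t).2, by simp [h0], by simp [h0], ?_⟩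
  filter_upwards [Icc_mem_nhds (neg_lt_zero.2 hε0) hε0,
    eventually_eventually_nhds.2 (Icc_mem_nhds (neg_lt_zero.2 hε0) hε0)] with t ht ht'
  have h := (hα t ht).hasDerivAt ht'
  exact ⟨h.fst, h.snd⟩

/-- If `y 0 = 0`, `y' = v`, `v 0 = 1` and `v' 0 = 0`, then the logarithmic derivative `v / y` is
`1 / r + o(1)` at `0`. -/
lemma tendsto_inv_sub_logDeriv_zero {y v : ℝ → ℝ} (hy0 : y 0 = 0) (hv0 : v 0 = 1)
    (hy : ∀ᶠ t in 𝓝 (0 : ℝ), HasDerivAt y (v t) t) (hv : HasDerivAt v 0 0) :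
    Tendsto (fun r => 1 / r - v r / y r) (𝓝[>] 0) (𝓝 0) := by
  have hle : 𝓝[>] (0 : ℝ) ≤ 𝓝[≠] 0 := nhdsWithin_mono _ fun x hx => ne_of_gt hx
  have hpos : ∀ᶠ r in 𝓝[>] (0 : ℝ), 0 < r := self_mem_nhdsWithin
  have hV : Tendsto (fun r => (v r - 1) / r) (𝓝[>] 0) (𝓝 0) := by
    refine (hv.tendsto_slope.mono_left hle).congr fun r => ?_
    simp [slope_def_field, hv0]
  have hyd : HasDerivAt y 1 0 := hv0 ▸ hy.self_of_nhds
  have hY : Tendsto (fun r => y r / r) (𝓝[>] 0) (𝓝 1) := by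
    refine (hyd.tendsto_slope.mono_left hle).congr fun r => ?_
    simp [slope_def_field, hy0]
  have hY2 : Tendsto (fun r => (y r - r) / r ^ 2) (𝓝[>] 0) (𝓝 0) := by
    refine HasDerivAt.lhopital_zero_nhdsGT (f' := fun r => v r - 1) (g' := fun r => 2 * r)
      ?_ ?_ ?_ ?_ ?_ ?_
    · filter_upwards [hy.filter_mono nhdsWithin_le_nhds] with r hr
      exact hr.sub (hasDerivAt_id r)
    · refine Eventually.of_forall fun r => ?_
      simpa using hasDerivAt_pow 2 r
    · filter_upwards [hpos] with r hr
      positivity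
    · have h : ContinuousAt (fun r => y r - r) 0 := hyd.continuousAt.sub continuousAt_id
      simpa [ContinuousAt, hy0] using h.tendsto.mono_left nhdsWithin_le_nhds
    · have h : Continuous (fun r : ℝ => r ^ 2) := by fun_prop
      simpa using (h.tendsto 0).mono_left nhdsWithin_le_nhds
    · have h := hV.div_const 2
      rw [zero_div] at h
      refine h.congr fun r => ?_
      rw [div_div, mul_comm]
  have hlim := (hY2.sub hV).div hY one_ne_zero
  rw [sub_zero, zero_div] at hlim
  refine hlim.congr' ?_
  filter_upwards [hpos, hY.eventually_ne one_ne_zero] with r hr hyr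
  have hy_ne : y r ≠ 0 := fun h => hyr (by simp [h])
  simp only [Pi.div_apply]
  field_simp
  ring

/-- Local existence, for `T'` small enough, of a positive solution
of the Raychaudhuri equation `τ' = -τ²/(n-1) - s` on `(0,T']` with
`(n-1)/r - τ(r) → 0` at the vertex. -/
theorem raychaudhuri_local_existence
    (n : ℕ) (hn : 2 ≤ n) (T : ℝ) (hT : 0 < T) (s : ℝ → ℝ)
    (hs_cont : ContinuousOn s (Icc (0:ℝ) T))
    (hs_nonneg : ∀ ρ ∈ Icc (0:ℝ) T, 0 ≤ s ρ) :
    ∃ T' : ℝ, T' ∈ Ioc (0:ℝ) T ∧ ∃ τ : ℝ → ℝ,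
      (∀ r ∈ Ioc (0:ℝ) T', 0 < τ r) ∧
      (∀ r ∈ Ioc (0:ℝ) T',
        HasDerivAt τ (-(τ r) ^ 2 / ((n : ℝ) - 1) - s r) r) ∧
      Tendsto (fun r : ℝ => ((n : ℝ) - 1) / r - τ r) (𝓝[>] 0) (𝓝 0) := by
  have hc : 0 < (n : ℝ) - 1 := by
    have : (2 : ℝ) ≤ n := by exact_mod_cast hn
    linarith
  set c : ℝ := (n : ℝ) - 1
  let q : ℝ → ℝ := fun t => IccExtend hT.le ((Icc 0 T).domRestrict s) t / c
  have hq : Continuous q := (hs_cont.domRestrict.Icc_extend').div_const c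
  have hqs : ∀ r ∈ Icc 0 T, q r = s r / c := fun r hr => by
    simp [q, IccExtend_of_mem _ _ hr]
  obtain ⟨y, v, hy0, hv0, hyv⟩ := exists_eventually_solution_linear_second_order hq
  have hyd : HasDerivAt y 1 0 := hv0 ▸ hyv.self_of_nhds.1
  have hvd : HasDerivAt v 0 0 := by simpa [hy0] using hyv.self_of_nhds.2
  have hvpos : ∀ᶠ t in 𝓝 (0 : ℝ), 0 < v t :=
    hvd.continuousAt.eventually (lt_mem_nhds (by simp [hv0]))
  have hypos : ∀ᶠ t in 𝓝[>] (0 : ℝ), 0 < y t := by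
    have hle : 𝓝[>] (0 : ℝ) ≤ 𝓝[≠] 0 := nhdsWithin_mono _ fun x hx => ne_of_gt hx
    filter_upwards [(hyd.tendsto_slope.mono_left hle).eventually (lt_mem_nhds one_pos),
      self_mem_nhdsWithin] with t ht ht0
    rw [slope_def_field, hy0, sub_zero, sub_zero] at ht
    exact (div_pos_iff_of_pos_right ht0).1 ht
  have hgood := hypos.and ((hyv.and hvpos).filter_mono nhdsWithin_le_nhds)
  obtain ⟨δ, hδ, hδgood⟩ := mem_nhdsGT_iff_exists_Ioc_subset.1 hgood
  refine ⟨min δ T, ⟨lt_min hδ hT, min_le_right _ _⟩, fun r => c * (v r / y r), ?_, ?_, ?_⟩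
  · intro r hr
    obtain ⟨h1, -, h3⟩ := hδgood ⟨hr.1, hr.2.trans (min_le_left _ _)⟩
    positivity
  · intro r hr
    obtain ⟨h1, ⟨h2, h2'⟩, -⟩ := hδgood ⟨hr.1, hr.2.trans (min_le_left _ _)⟩
    refine ((h2'.div h2 h1.ne').const_mul c).congr_deriv ?_
    rw [hqs r ⟨hr.1.le, hr.2.trans (min_le_right _ _)⟩]
    field_simp
    ring
  · have h := (tendsto_inv_sub_logDeriv_zero hy0 hv0 (hyv.mono fun _ h => h.1) hvd).const_mul c
    rw [mul_zero] at h
    refine h.congr fun r => ?_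
    ring
end

section
/- Let n ≥ 2 be an integer and B > 0. There exists ε > 0 such that for every continuous function s : [0,∞) → ℝ with 0 ≤ s(ρ) ≤ B for all ρ and ∫₀^∞ ρ²·s(ρ) dρ < ε, there exists a differentiable function τ : (0,∞) → (0,∞) satisfying the Raychaudhuri equation τ'(r) = −τ(r)²/(n−1) − s(r) for all r ∈ (0,∞) and such that (n−1)/r − τ(r) → 0 as r → 0⁺. -/
open Set Filter Topology MeasureTheory

open scoped BoundedContinuousFunction

lemma abs_intervalIntegral_le_norm_mul (v : ℝ →ᵇ ℝ) {r : ℝ} (hr : 0 ≤ r) :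
    |∫ x in (0:ℝ)..r, v x| ≤ ‖v‖ * r := by
  have h := intervalIntegral.norm_integral_le_of_norm_le_const (a := 0) (b := r) (f := v)
    (C := ‖v‖) (fun x _ => v.norm_coe_le_norm x)
  simpa [abs_of_nonneg hr] using h

lemma continuous_intervalIntegral_boundedContinuous (v : ℝ →ᵇ ℝ) :
    Continuous fun r : ℝ => ∫ x in (0:ℝ)..r, v x :=
  intervalIntegral.continuous_primitive (fun a b => v.continuous.intervalIntegrable a b) 0

lemma abs_integral_mul_primitive_le {q : ℝ → ℝ} (hq : Continuous q) (hq0 : ∀ x, 0 ≤ q x)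
    {κ : ℝ} (hκ : ∀ R, 0 ≤ R → ∫ x in (0:ℝ)..R, x * q x ≤ κ) (v : ℝ →ᵇ ℝ)
    {R : ℝ} (hR : 0 ≤ R) :
    |∫ x in (0:ℝ)..R, q x * ∫ y in (0:ℝ)..x, v y| ≤ κ * ‖v‖ := by
  have hU := continuous_intervalIntegral_boundedContinuous v
  calc |∫ x in (0:ℝ)..R, q x * ∫ y in (0:ℝ)..x, v y|
      ≤ ∫ x in (0:ℝ)..R, |q x * ∫ y in (0:ℝ)..x, v y| :=
        intervalIntegral.abs_integral_le_integral_abs hR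
    _ ≤ ∫ x in (0:ℝ)..R, ‖v‖ * (x * q x) := by
        refine intervalIntegral.integral_mono_on hR
          ((hq.mul hU).abs.intervalIntegrable _ _)
          ((continuous_const.mul (continuous_id.mul hq)).intervalIntegrable _ _) ?_
        intro x hx
        rw [abs_mul, abs_of_nonneg (hq0 x)]
        have := mul_le_mul_of_nonneg_left (abs_intervalIntegral_le_norm_mul v hx.1) (hq0 x)
        linarith
    _ = ‖v‖ * ∫ x in (0:ℝ)..R, x * q x := intervalIntegral.integral_const_mul _ _
    _ ≤ κ * ‖v‖ := by
        rw [mul_comm κ]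
        exact mul_le_mul_of_nonneg_left (hκ R hR) (norm_nonneg _)

/-- The integral operator whose fixed point is the derivative of the solution of
`u'' = -q u`, `u 0 = 0`, `u' 0 = 1`. -/
noncomputable def jacobiOperator {q : ℝ → ℝ} (hq : Continuous q) (hq0 : ∀ x, 0 ≤ q x)
    {κ : ℝ} (hκ : ∀ R, 0 ≤ R → ∫ x in (0:ℝ)..R, x * q x ≤ κ) (v : ℝ →ᵇ ℝ) : ℝ →ᵇ ℝ :=
  BoundedContinuousFunction.ofNormedAddCommGroup
    (fun r => 1 - ∫ x in (0:ℝ)..|r|, q x * ∫ y in (0:ℝ)..x, v y)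
    (continuous_const.sub ((intervalIntegral.continuous_primitive
      (fun a b => (hq.mul (continuous_intervalIntegral_boundedContinuous v)).intervalIntegrable
        a b) 0).comp continuous_abs))
    (1 + κ * ‖v‖)
    (fun r => by
      refine (norm_sub_le _ _).trans ?_
      have := abs_integral_mul_primitive_le hq hq0 hκ v (abs_nonneg r)
      rw [norm_one, Real.norm_eq_abs]
      linarith)

lemma exists_pos_jacobi_derivative {q : ℝ → ℝ} (hq : Continuous q) (hq0 : ∀ x, 0 ≤ q x)
    (hκ : ∀ R, 0 ≤ R → ∫ x in (0:ℝ)..R, x * q x ≤ 1 / 4) :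
    ∃ v : ℝ →ᵇ ℝ, ‖v‖ ≤ 2 ∧ (∀ r, 1 / 2 ≤ v r) ∧
      ∀ r, 0 ≤ r → v r = 1 - ∫ x in (0:ℝ)..r, q x * ∫ y in (0:ℝ)..x, v y := by
  have hc : ContractingWith (1 / 4) (jacobiOperator hq hq0 hκ) := by
    refine ⟨by rw [← NNReal.coe_lt_coe]; norm_num, LipschitzWith.of_dist_le_mul fun v w => ?_⟩
    refine (BoundedContinuousFunction.dist_le (by positivity)).2 fun r => ?_
    have hi : ∀ f : ℝ →ᵇ ℝ, IntervalIntegrable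
        (fun x => q x * ∫ y in (0:ℝ)..x, f y) volume 0 |r| := fun f =>
      (hq.mul (continuous_intervalIntegral_boundedContinuous f)).intervalIntegrable _ _
    have he : jacobiOperator hq hq0 hκ w r - jacobiOperator hq hq0 hκ v r
        = ∫ x in (0:ℝ)..|r|, q x * ∫ y in (0:ℝ)..x, (v - w) y := by
      have h1 : (fun x => q x * ∫ y in (0:ℝ)..x, (v - w) y) = fun x =>
          (q x * ∫ y in (0:ℝ)..x, v y) - q x * ∫ y in (0:ℝ)..x, w y := by
        funext x
        rw [← mul_sub, ← intervalIntegral.integral_sub (v.continuous.intervalIntegrable _ _)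
          (w.continuous.intervalIntegrable _ _)]
        rfl
      rw [h1, intervalIntegral.integral_sub (hi v) (hi w)]
      simp only [jacobiOperator, BoundedContinuousFunction.coe_ofNormedAddCommGroup]
      ring
    rw [dist_comm, Real.dist_eq, he, dist_eq_norm]
    simpa using abs_integral_mul_primitive_le hq hq0 hκ (v - w) (abs_nonneg r)
  obtain ⟨v, hv⟩ : ∃ v, jacobiOperator hq hq0 hκ v = v :=
    ⟨_, hc.fixedPoint_isFixedPt⟩
  have hf : ∀ r, v r = 1 - ∫ x in (0:ℝ)..|r|, q x * ∫ y in (0:ℝ)..x, v y := fun r => by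
    conv_lhs => rw [← hv]
    rfl
  have hb := fun r : ℝ => abs_le.1 (abs_integral_mul_primitive_le hq hq0 hκ v (abs_nonneg r))
  have hn : ‖v‖ ≤ 1 + 1 / 4 * ‖v‖ := by
    refine (BoundedContinuousFunction.norm_le (by positivity)).2 fun r => ?_
    rw [Real.norm_eq_abs, abs_le, hf r]
    constructor <;> linarith [hb r, (hb r).1, (hb r).2]
  refine ⟨v, by linarith, fun r => ?_, fun r hr => ?_⟩
  · rw [hf r]
    linarith [(hb r).2]
  · simpa [abs_of_nonneg hr] using hf r

lemma intervalIntegral_mul_le_of_lintegral_sq {s : ℝ → ℝ} {B δ : ℝ} (hB : 0 ≤ B) (hδ : 0 < δ)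
    (hs : ∀ x, 0 ≤ x → 0 ≤ s x ∧ s x ≤ B) (hsc : Continuous s) {ε : ℝ} (hε : 0 ≤ ε)
    (h : (∫⁻ x in Ioi (0:ℝ), ENNReal.ofReal (x ^ 2 * s x)) ≤ ENNReal.ofReal ε)
    {R : ℝ} (hR : 0 ≤ R) :
    ∫ x in (0:ℝ)..R, x * s x ≤ B * δ ^ 2 + δ⁻¹ * ε := by
  rw [intervalIntegral.integral_of_le hR, integral_eq_lintegral_of_nonneg_ae
    ((ae_restrict_iff' measurableSet_Ioc).2
      (ae_of_all _ fun x hx => mul_nonneg hx.1.le (hs x hx.1.le).1))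
    (continuous_id.mul hsc).aestronglyMeasurable]
  refine ENNReal.toReal_le_of_le_ofReal (by positivity) ?_
  calc ∫⁻ x in Ioc 0 R, ENNReal.ofReal (x * s x)
      ≤ ∫⁻ x in Ioi (0:ℝ), ENNReal.ofReal (x * s x) :=
        lintegral_mono_set Ioc_subset_Ioi_self
    _ ≤ ∫⁻ x in Ioi (0:ℝ), ((Ioc 0 δ).indicator (fun _ => ENNReal.ofReal (B * δ)) x
          + ENNReal.ofReal δ⁻¹ * ENNReal.ofReal (x ^ 2 * s x)) := by
        refine setLIntegral_mono' measurableSet_Ioi fun x hx => ?_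
        have hx : 0 < x := hx
        obtain ⟨h0, h1⟩ := hs x hx.le
        by_cases hxd : x ≤ δ
        · rw [indicator_of_mem (show x ∈ Ioc 0 δ from ⟨hx, hxd⟩)]
          refine le_add_right (ENNReal.ofReal_le_ofReal ?_)
          nlinarith [mul_le_mul hxd h1 h0 hδ.le]
        · refine le_add_left ?_
          rw [← ENNReal.ofReal_mul (by positivity)]
          refine ENNReal.ofReal_le_ofReal ?_
          rw [inv_mul_eq_div, le_div_iff₀ hδ]
          nlinarith [mul_le_mul_of_nonneg_left (not_le.1 hxd).le (mul_nonneg hx.le h0)]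
    _ = ENNReal.ofReal (B * δ) * ENNReal.ofReal δ
          + ENNReal.ofReal δ⁻¹ * ∫⁻ x in Ioi (0:ℝ), ENNReal.ofReal (x ^ 2 * s x) := by
        rw [lintegral_add_left (measurable_const.indicator measurableSet_Ioc),
          lintegral_const_mul' _ _ ENNReal.ofReal_ne_top,
          lintegral_indicator_const measurableSet_Ioc,
          Measure.restrict_apply measurableSet_Ioc,
          inter_eq_left.2 (Ioc_subset_Ioi_self : Ioc 0 δ ⊆ Ioi 0), Real.volume_Ioc, sub_zero]
    _ ≤ ENNReal.ofReal (B * δ) * ENNReal.ofReal δ + ENNReal.ofReal δ⁻¹ * ENNReal.ofReal ε := by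
        gcongr
    _ = ENNReal.ofReal (B * δ ^ 2 + δ⁻¹ * ε) := by
        rw [← ENNReal.ofReal_mul (by positivity), ← ENNReal.ofReal_mul (by positivity),
          ← ENNReal.ofReal_add (by positivity) (by positivity)]
        ring_nf

/-- Global existence of a positive solution of the Raychaudhuri
equation on `(0,∞)` with `(n-1)/r - τ(r) → 0` at the vertex, provided the
shear term `s` is bounded by `B` and `∫₀^∞ ρ² s(ρ) dρ` is small enough. -/
theorem raychaudhuri_global_existence
    (n : ℕ) (hn : 2 ≤ n) (B : ℝ) (hB : 0 < B) :
    ∃ ε > (0:ℝ), ∀ s : ℝ → ℝ,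
      ContinuousOn s (Ici (0:ℝ)) →
      (∀ ρ : ℝ, 0 ≤ ρ → 0 ≤ s ρ ∧ s ρ ≤ B) →
      (∫⁻ ρ in Ioi (0:ℝ), ENNReal.ofReal (ρ ^ 2 * s ρ)) < ENNReal.ofReal ε →
      ∃ τ : ℝ → ℝ,
        (∀ r : ℝ, 0 < r → 0 < τ r) ∧
        (∀ r : ℝ, 0 < r →
          HasDerivAt τ (-(τ r) ^ 2 / ((n : ℝ) - 1) - s r) r) ∧
        Tendsto (fun r : ℝ => ((n : ℝ) - 1) / r - τ r) (𝓝[>] 0) (𝓝 0) := by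
  have hm : (1:ℝ) ≤ (n : ℝ) - 1 := by
    have : (2:ℝ) ≤ n := by exact_mod_cast hn
    linarith
  generalize (n : ℝ) - 1 = m at hm
  have hm0 : 0 < m := by linarith
  set δ : ℝ := 1 / (8 * (B + 1)) with hδ
  have hδ0 : 0 < δ := by positivity
  have hBδ : B * δ ^ 2 ≤ 1 / 8 := by
    rw [hδ, div_pow, one_pow, mul_one_div, div_le_div_iff₀ (by positivity) (by norm_num)]
    nlinarith
  refine ⟨δ / 8, by positivity, fun s hsc hs hint => ?_⟩
  have hsac : Continuous fun x => s |x| :=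
    hsc.comp_continuous continuous_abs fun x => abs_nonneg x
  have hsb : ∀ x, 0 ≤ s |x| ∧ s |x| ≤ B := fun x => hs _ (abs_nonneg x)
  set q : ℝ → ℝ := fun x => s |x| / m with hqdef
  have hq : Continuous q := hsac.div_const m
  have hq0 : ∀ x, 0 ≤ q x := fun x => div_nonneg (hsb x).1 hm0.le
  have hqB : ∀ x, q x ≤ B := fun x => (div_le_self (hsb x).1 hm).trans (hsb x).2
  have hκ : ∀ R, 0 ≤ R → ∫ x in (0:ℝ)..R, x * q x ≤ 1 / 4 := fun R hR => by
    have hlin : (∫⁻ x in Ioi (0:ℝ), ENNReal.ofReal (x ^ 2 * q x)) ≤ ENNReal.ofReal (δ / 8) := by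
      refine le_trans (setLIntegral_mono' measurableSet_Ioi fun x hx => ?_) hint.le
      have hx : 0 < x := hx
      refine ENNReal.ofReal_le_ofReal (mul_le_mul_of_nonneg_left ?_ (sq_nonneg x))
      simpa only [hqdef, abs_of_pos hx] using div_le_self (hsb x).1 hm
    have := intervalIntegral_mul_le_of_lintegral_sq hB.le hδ0 (fun x _ => ⟨hq0 x, hqB x⟩) hq
      (by positivity) hlin hR
    have h8 : δ⁻¹ * (δ / 8) = 1 / 8 := by field_simp
    linarith
  obtain ⟨v, hv2, hvpos, hv⟩ := exists_pos_jacobi_derivative hq hq0 hκ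
  set U : ℝ → ℝ := fun r => ∫ x in (0:ℝ)..r, v x with hU
  have hUc : Continuous U := continuous_intervalIntegral_boundedContinuous v
  have hU' : ∀ r, HasDerivAt U (v r) r := fun r =>
    intervalIntegral.integral_hasDerivAt_right (v.continuous.intervalIntegrable _ _)
      (v.continuous.stronglyMeasurableAtFilter _ _) v.continuous.continuousAt
  have hv' : ∀ r, 0 < r → HasDerivAt v (-(q r * U r)) r := fun r hr => by
    have h1 : HasDerivAt (fun r => ∫ x in (0:ℝ)..r, q x * U x) (q r * U r) r :=
      intervalIntegral.integral_hasDerivAt_right ((hq.mul hUc).intervalIntegrable _ _)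
        ((hq.mul hUc).stronglyMeasurableAtFilter _ _) (hq.mul hUc).continuousAt
    refine (h1.const_sub 1).congr_of_eventuallyEq ?_
    filter_upwards [lt_mem_nhds hr] with x hx
    exact hv x hx.le
  have hUpos : ∀ r, 0 < r → r / 2 ≤ U r := fun r hr => by
    have h := intervalIntegral.integral_mono_on hr.le
      (intervalIntegrable_const (c := (1 / 2 : ℝ)) (μ := volume))
      (v.continuous.intervalIntegrable 0 r) (fun x _ => hvpos x)
    simp only [intervalIntegral.integral_const, sub_zero, smul_eq_mul] at h
    linarith
  have hUle : ∀ r, 0 ≤ r → |U r| ≤ 2 * r := fun r hr =>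
    (abs_intervalIntegral_le_norm_mul v hr).trans (mul_le_mul_of_nonneg_right hv2 hr)
  have hv1 : ∀ r, 0 ≤ r → |v r - 1| ≤ 2 * B * r ^ 2 := fun r hr => by
    have h := intervalIntegral.norm_integral_le_of_norm_le_const (a := 0) (b := r)
      (f := fun x => q x * U x) (C := B * (2 * r)) (fun x hx => by
        rw [uIoc_of_le hr] at hx
        rw [norm_mul, Real.norm_eq_abs, Real.norm_eq_abs, abs_of_nonneg (hq0 x)]
        exact mul_le_mul (hqB x) ((hUle x hx.1.le).trans (by linarith [hx.2]))
          (abs_nonneg _) hB.le)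
    rw [hv r hr, sub_sub_cancel_left, abs_neg]
    rw [sub_zero, abs_of_nonneg hr, Real.norm_eq_abs] at h
    linarith
  have hU1 : ∀ r, 0 ≤ r → |U r - r| ≤ 2 * B * r ^ 3 := fun r hr => by
    have h := intervalIntegral.norm_integral_le_of_norm_le_const (a := 0) (b := r)
      (f := fun x => v x - 1) (C := 2 * B * r ^ 2) (fun x hx => by
        rw [uIoc_of_le hr] at hx
        refine (hv1 x hx.1.le).trans ?_
        have := pow_le_pow_left₀ hx.1.le hx.2 2
        gcongr)
    rw [intervalIntegral.integral_sub (v.continuous.intervalIntegrable _ _)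
      intervalIntegrable_const] at h
    simp only [intervalIntegral.integral_const, sub_zero, smul_eq_mul, mul_one,
      Real.norm_eq_abs, abs_of_nonneg hr] at h
    linarith
  refine ⟨fun r => m * v r / U r, fun r hr => ?_, fun r hr => ?_, ?_⟩
  · have := hUpos r hr
    have := hvpos r
    exact div_pos (mul_pos hm0 (by linarith)) (by linarith)
  · have hUr : U r ≠ 0 := ((half_pos hr).trans_le (hUpos r hr)).ne'
    refine (((hv' r hr).const_mul m).div (hU' r) hUr).congr_deriv ?_
    simp only [hqdef, abs_of_pos hr]
    field_simp
    ring
  · have hlim : Tendsto (fun r : ℝ => 8 * m * B * r) (𝓝[>] 0) (𝓝 0) := by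
      have : Continuous fun r : ℝ => 8 * m * B * r := by fun_prop
      simpa using (this.tendsto 0).mono_left nhdsWithin_le_nhds
    refine squeeze_zero_norm' ?_ hlim
    filter_upwards [self_mem_nhdsWithin] with r hr
    have hr : 0 < r := hr
    have hUr : 0 < U r := by linarith [hUpos r hr]
    have he : m / r - m * v r / U r = m * ((U r - r) - r * (v r - 1)) / (r * U r) := by
      field_simp
      ring
    have hnum : |(U r - r) - r * (v r - 1)| ≤ 4 * B * r ^ 3 := by
      refine (abs_sub _ _).trans ?_
      rw [abs_mul, abs_of_pos hr]
      nlinarith [hU1 r hr.le, mul_le_mul_of_nonneg_left (hv1 r hr.le) hr.le]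
    rw [he, Real.norm_eq_abs, abs_div, abs_mul, abs_of_pos hm0, abs_of_pos (mul_pos hr hUr),
      div_le_iff₀ (mul_pos hr hUr)]
    calc m * |(U r - r) - r * (v r - 1)| ≤ m * (4 * B * r ^ 3) := by gcongr
      _ = 8 * m * B * r * (r * (r / 2)) := by ring
      _ ≤ 8 * m * B * r * (r * U r) := by
        have := hUpos r hr
        gcongr
end

section
/- Let n ≥ 2 be an integer, R ∈ (0,∞], and let s : [0,R) → ℝ be continuous with s(ρ) ≥ 0 for all ρ. Suppose τ : (0,R) → (0,∞) is differentiable, satisfies the Raychaudhuri equation τ'(r) = −τ(r)²/(n−1) − s(r) for all r ∈ (0,R), and r·τ(r) → n−1 as r → 0⁺. Then for every r ∈ (0,R): (n−1) − r·τ(r) ≤ ∫₀^r ρ·s(ρ) dρ; equivalently τ(r) ≥ (n−1)/r − (1/r)·∫₀^r ρ·s(ρ) dρ. -/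
open Set Filter Topology MeasureTheory intervalIntegral

/-- A function on `(a, b]` with nonnegative derivative on `(a, b)` is bounded below at `b`
by its right limit at `a`. -/
theorem le_of_tendsto_of_hasDerivAt_nonneg {f f' : ℝ → ℝ} {a b L : ℝ} (hab : a < b)
    (hc : ContinuousOn f (Ioc a b)) (hd : ∀ x ∈ Ioo a b, HasDerivAt f (f' x) x)
    (hf' : ∀ x ∈ Ioo a b, 0 ≤ f' x) (hL : Tendsto f (𝓝[>] a) (𝓝 L)) : L ≤ f b := by
  have hmono : MonotoneOn f (Ioc a b) := by
    refine monotoneOn_of_hasDerivWithinAt_nonneg (f' := f') (convex_Ioc a b) hc ?_ ?_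
    · intro x hx
      rw [interior_Ioc] at hx ⊢
      exact (hd x hx).hasDerivWithinAt
    · intro x hx
      rw [interior_Ioc] at hx
      exact hf' x hx
  refine le_of_tendsto hL ?_
  filter_upwards [Ioo_mem_nhdsGT hab] with x hx
  exact hmono ⟨hx.1, hx.2.le⟩ ⟨hab, le_rfl⟩ hx.2.le

/-- A positive solution of the Raychaudhuri equation on `(0,R)`,
`R ∈ (0,∞]`, with `r τ(r) → n-1` at the vertex, satisfies the lower bound
`(n-1) - r τ(r) ≤ ∫₀^r ρ s(ρ) dρ`, i.e. `τ(r) ≥ (n-1)/r - (1/r)∫₀^r ρ s(ρ) dρ`. -/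
theorem raychaudhuri_lower_bound
    (n : ℕ) (hn : 2 ≤ n) (R : EReal) (hR : 0 < R) (s τ : ℝ → ℝ)
    (hs_cont : ContinuousOn s {ρ : ℝ | 0 ≤ ρ ∧ (ρ : EReal) < R})
    (hs_nonneg : ∀ ρ : ℝ, 0 ≤ ρ → (ρ : EReal) < R → 0 ≤ s ρ)
    (hτ_pos : ∀ r : ℝ, 0 < r → (r : EReal) < R → 0 < τ r)
    (hτ : ∀ r : ℝ, 0 < r → (r : EReal) < R →
      HasDerivAt τ (-(τ r) ^ 2 / ((n : ℝ) - 1) - s r) r)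
    (hlim : Tendsto (fun r : ℝ => r * τ r) (𝓝[>] 0) (𝓝 ((n : ℝ) - 1))) :
    ∀ r : ℝ, 0 < r → (r : EReal) < R →
      (((n : ℝ) - 1) - r * τ r ≤ ∫ ρ in (0:ℝ)..r, ρ * s ρ) ∧
      (((n : ℝ) - 1) / r - (1 / r) * ∫ ρ in (0:ℝ)..r, ρ * s ρ ≤ τ r) := by
  have hm : (0 : ℝ) < (n : ℝ) - 1 := by
    have : (2 : ℝ) ≤ n := by exact_mod_cast hn
    linarith
  set m : ℝ := (n : ℝ) - 1
  have hlt : ∀ {x y : ℝ}, x ≤ y → (y : EReal) < R → (x : EReal) < R := fun hxy hy =>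
    (EReal.coe_le_coe_iff.2 hxy).trans_lt hy
  have hτ_le : ∀ r : ℝ, 0 < r → (r : EReal) < R → r * τ r ≤ m := by
    intro r hr hrR
    have hd : ∀ x ∈ Ioc 0 r, HasDerivAt (fun x => (τ x)⁻¹ - x / m)
        (-(-(τ x) ^ 2 / m - s x) / (τ x) ^ 2 - 1 / m) x := fun x hx =>
      ((hτ x hx.1 (hlt hx.2 hrR)).inv (hτ_pos x hx.1 (hlt hx.2 hrR)).ne').sub
        ((hasDerivAt_id x).div_const m)
    have hL : Tendsto (fun x => (τ x)⁻¹ - x / m) (𝓝[>] 0) (𝓝 0) := by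
      have hid : Tendsto (fun x : ℝ => x) (𝓝[>] 0) (𝓝 0) := nhdsWithin_le_nhds
      have h := (hid.div hlim hm.ne').sub (hid.div_const m)
      simp only [zero_div, sub_zero] at h
      refine h.congr' ?_
      filter_upwards [self_mem_nhdsWithin] with x hx
      have hx : x ≠ 0 := ne_of_gt hx
      simp only [Pi.div_apply]
      rw [div_mul_cancel_left₀ hx]
    have h := le_of_tendsto_of_hasDerivAt_nonneg hr
      (fun x hx => (hd x hx).continuousAt.continuousWithinAt)
      (fun x hx => hd x ⟨hx.1, hx.2.le⟩) (fun x hx => ?_) hL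
    · have hp := hτ_pos r hr hrR
      have h' : r / m ≤ 1 / τ r := by
        rw [one_div]
        linarith
      rw [div_le_div_iff₀ hm hp] at h'
      linarith
    · have hxR := hlt hx.2.le hrR
      have hp := hτ_pos x hx.1 hxR
      have hs := hs_nonneg x hx.1.le hxR
      have : -(-(τ x) ^ 2 / m - s x) / (τ x) ^ 2 - 1 / m = s x / (τ x) ^ 2 := by
        field_simp
        ring
      rw [this]
      positivity
  intro r hr hrR
  have hcont : ContinuousOn (fun ρ => ρ * s ρ) (Icc 0 r) :=
    continuousOn_id.mul (hs_cont.mono fun x hx => ⟨hx.1, hlt hx.2 hrR⟩)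
  have hint : IntervalIntegrable (fun ρ => ρ * s ρ) volume 0 r :=
    hcont.intervalIntegrable_of_Icc hr.le
  have hF : ContinuousOn (fun x => ∫ ρ in (0 : ℝ)..x, ρ * s ρ) (Icc 0 r) := by
    have h := continuousOn_primitive_interval' hint left_mem_uIcc
    rwa [uIcc_of_le hr.le] at h
  have hF0 : Tendsto (fun x => ∫ ρ in (0 : ℝ)..x, ρ * s ρ) (𝓝[>] 0) (𝓝 0) := by
    have h := (hF 0 ⟨le_rfl, hr.le⟩).mono_of_mem_nhdsWithin (Icc_mem_nhdsGT hr)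
    simpa [ContinuousWithinAt] using h
  have hF' : ∀ x ∈ Ioo 0 r, HasDerivAt (fun x => ∫ ρ in (0 : ℝ)..x, ρ * s ρ) (x * s x) x := by
    intro x hx
    refine integral_hasDerivAt_right ?_ ?_ (hcont.continuousAt (Icc_mem_nhds hx.1 hx.2))
    · exact (hcont.mono (Icc_subset_Icc_right hx.2.le)).intervalIntegrable_of_Icc hx.1.le
    · exact (hcont.mono Ioo_subset_Icc_self).stronglyMeasurableAtFilter isOpen_Ioo x hx
  have hu : ∀ x ∈ Ioc 0 r, HasDerivAt (fun x => x * τ x)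
      (1 * τ x + x * (-(τ x) ^ 2 / m - s x)) x := fun x hx =>
    (hasDerivAt_id x).mul (hτ x hx.1 (hlt hx.2 hrR))
  have hL := hlim.add hF0
  rw [add_zero] at hL
  have key := le_of_tendsto_of_hasDerivAt_nonneg hr
    (ContinuousOn.add (fun x hx => (hu x hx).continuousAt.continuousWithinAt)
      (hF.mono Ioc_subset_Icc_self))
    (fun x hx => (hu x ⟨hx.1, hx.2.le⟩).add (hF' x hx)) (fun x hx => ?_) hL
  · have h1 : m - r * τ r ≤ ∫ ρ in (0 : ℝ)..r, ρ * s ρ :=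
      sub_le_iff_le_add'.2 key
    refine ⟨h1, ?_⟩
    rw [one_div_mul_eq_div, ← sub_div, div_le_iff₀ hr]
    linarith
  · have hxR := hlt hx.2.le hrR
    have hp := hτ_pos x hx.1 hxR
    have : 1 * τ x + x * (-(τ x) ^ 2 / m - s x) + x * s x = τ x * (m - x * τ x) / m := by
      field_simp
      ring
    rw [this]
    exact div_nonneg (mul_nonneg hp.le (sub_nonneg.2 (hτ_le x hx.1 hxR))) hm.le
end

section
/- Let k > 0, T > 0, and let F : [0,T] × ℝ → ℝ be continuous and Lipschitz in its second variable, uniformly with respect to the first. Then there exist T' ∈ (0,T] and a unique continuous function y : [0,T'] → ℝ with y(0) = 0 which is differentiable on (0,T'] and satisfies the singular ordinary differential equation y'(r) + (k/r)·y(r) = F(r, y(r)) for all r ∈ (0,T']. -/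
open Set Filter Topology

/-- The property of being a solution of the singular (Fuchsian-type) initial
value problem `y' + (k/r) y = F(r, y)` on `(0,T']` with `y(0) = 0`, `y`
continuous on `[0,T']`. -/
def IsSingularODESolution (k T' : ℝ) (F : ℝ → ℝ → ℝ) (y : ℝ → ℝ) : Prop :=
  ContinuousOn y (Set.Icc 0 T') ∧ y 0 = 0 ∧
    ∀ r ∈ Set.Ioc (0:ℝ) T', HasDerivAt y (F r (y r) - (k / r) * y r) r

/-- Two solutions of the singular initial value problem agree when `F` is Lipschitz in its second
variable and `k` is nonnegative: `exp (-2 L r) * (y₁ - y₂) ^ 2` is nonincreasing. -/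
theorem IsSingularODESolution.eqOn {k T' : ℝ} {F : ℝ → ℝ → ℝ} {L : NNReal} {y₁ y₂ : ℝ → ℝ}
    (hk : 0 ≤ k) (hF : ∀ r ∈ Icc (0 : ℝ) T', LipschitzWith L (F r))
    (h₁ : IsSingularODESolution k T' F y₁) (h₂ : IsSingularODESolution k T' F y₂) :
    EqOn y₁ y₂ (Icc 0 T') := by
  obtain ⟨hc₁, h0₁, hd₁⟩ := h₁
  obtain ⟨hc₂, h0₂, hd₂⟩ := h₂
  have hderiv : ∀ r ∈ Ioc (0 : ℝ) T',
      HasDerivAt (fun r => Real.exp (-(2 * L * r)) * (y₁ r - y₂ r) ^ 2)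
        (Real.exp (-(2 * L * r)) * (2 * ((y₁ r - y₂ r) * (F r (y₁ r) - F r (y₂ r))
          - L * (y₁ r - y₂ r) ^ 2 - k / r * (y₁ r - y₂ r) ^ 2))) r := by
    intro r hr
    have he : HasDerivAt (fun r : ℝ => Real.exp (-(2 * L * r)))
        (Real.exp (-(2 * L * r)) * (-(2 * L * 1))) r :=
      (((hasDerivAt_id r).const_mul (2 * (L : ℝ))).neg).exp
    refine (he.mul (((hd₁ r hr).sub (hd₂ r hr)).pow 2)).congr_deriv ?_
    simp only [Pi.sub_apply, Pi.pow_apply]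
    push_cast
    ring
  have hanti : AntitoneOn (fun r => Real.exp (-(2 * L * r)) * (y₁ r - y₂ r) ^ 2) (Icc 0 T') := by
    refine antitoneOn_of_deriv_nonpos (convex_Icc 0 T') ?_ ?_ ?_
    · exact (by fun_prop : Continuous fun r : ℝ => Real.exp (-(2 * L * r))).continuousOn.mul
        ((hc₁.sub hc₂).pow 2)
    · rw [interior_Icc]
      exact fun r hr => (hderiv r ⟨hr.1, hr.2.le⟩).differentiableAt.differentiableWithinAt
    · rw [interior_Icc]
      intro r hr
      rw [(hderiv r ⟨hr.1, hr.2.le⟩).deriv]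
      have hlip := (hF r ⟨hr.1.le, hr.2.le⟩).dist_le_mul (y₁ r) (y₂ r)
      rw [Real.dist_eq, Real.dist_eq] at hlip
      have hprod : (y₁ r - y₂ r) * (F r (y₁ r) - F r (y₂ r)) ≤ L * (y₁ r - y₂ r) ^ 2 :=
        calc (y₁ r - y₂ r) * (F r (y₁ r) - F r (y₂ r))
            ≤ |y₁ r - y₂ r| * |F r (y₁ r) - F r (y₂ r)| := by
              rw [← abs_mul]; exact le_abs_self _
          _ ≤ |y₁ r - y₂ r| * (L * |y₁ r - y₂ r|) := by gcongr
          _ = L * (y₁ r - y₂ r) ^ 2 := by rw [← sq_abs (y₁ r - y₂ r)]; ring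
      have hsing : 0 ≤ k / r * (y₁ r - y₂ r) ^ 2 :=
        mul_nonneg (div_nonneg hk hr.1.le) (sq_nonneg _)
      exact mul_nonpos_of_nonneg_of_nonpos (Real.exp_pos _).le (by linarith)
  intro r hr
  have hle := hanti ⟨le_rfl, hr.1.trans hr.2⟩ hr hr.1
  simp only [h0₁, h0₂, sub_self, ne_eq, OfNat.ofNat_ne_zero, not_false_eq_true, zero_pow,
    mul_zero] at hle
  have hsq : (y₁ r - y₂ r) ^ 2 ≤ 0 := nonpos_of_mul_nonpos_right hle (Real.exp_pos _)
  exact sub_eq_zero.1 (pow_eq_zero_iff two_ne_zero |>.1 (le_antisymm hsq (sq_nonneg _)))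

/-- If `h` is continuous, then `r * ∫ s in 0..1, s ^ k * h (r * s)`, which equals
`r ^ (-k) * ∫ ρ in 0..r, ρ ^ k * h ρ`, solves the linear equation `y' + (k / r) y = h`. -/
theorem hasDerivAt_mul_integral_rpow_mul_comp {k : ℝ} (hk : 0 ≤ k) {h : ℝ → ℝ}
    (hh : Continuous h) {r : ℝ} (hr : 0 < r) :
    HasDerivAt (fun r => r * ∫ s in (0 : ℝ)..1, s ^ k * h (r * s))
      (h r - k / r * (r * ∫ s in (0 : ℝ)..1, s ^ k * h (r * s))) r := by
  have hform : ∀ x : ℝ, 0 < x → x * ∫ s in (0 : ℝ)..1, s ^ k * h (x * s)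
      = x ^ (-k) * ∫ ρ in (0 : ℝ)..x, ρ ^ k * h ρ := by
    intro x hx
    have hsub := intervalIntegral.mul_integral_comp_mul_left (a := 0) (b := 1)
      (f := fun ρ : ℝ => ρ ^ k * h ρ) x
    rw [mul_zero, mul_one] at hsub
    rw [← hsub, mul_left_comm, ← intervalIntegral.integral_const_mul (x ^ (-k))]
    refine congrArg (x * ·) ?_
    refine intervalIntegral.integral_congr fun s hs => ?_
    rw [uIcc_of_le zero_le_one] at hs
    have hxk : x ^ (-k) * x ^ k = 1 := by rw [← Real.rpow_add hx]; simp
    rw [Real.mul_rpow hx.le hs.1]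
    linear_combination (-(s ^ k * h (x * s))) * hxk
  have hcont : Continuous fun ρ : ℝ => ρ ^ k * h ρ := (Real.continuous_rpow_const hk).mul hh
  have h_int : HasDerivAt (fun x => ∫ ρ in (0 : ℝ)..x, ρ ^ k * h ρ) (r ^ k * h r) r :=
    (hcont.integral_hasStrictDerivAt 0 r).hasDerivAt
  have hpow : HasDerivAt (fun x : ℝ => x ^ (-k)) (-k * r ^ (-k - 1)) r :=
    Real.hasDerivAt_rpow_const (Or.inl hr.ne')
  have hprod := (hpow.mul h_int).congr_of_eventuallyEq
    (f₁ := fun r => r * ∫ s in (0 : ℝ)..1, s ^ k * h (r * s))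
    ((eventually_gt_nhds hr).mono hform)
  refine hprod.congr_deriv ?_
  have hrk : r ^ (-k) * r ^ k = 1 := by rw [← Real.rpow_add hr]; simp
  rw [hform r hr, Real.rpow_sub hr, Real.rpow_one]
  linear_combination h r * hrk

/-- Banach fixed point for the integral form of the singular equation on `[0, a]` with `L a < 1`. -/
theorem exists_continuous_eq_mul_integral_rpow {k a : ℝ} (hk : 0 ≤ k) (ha : 0 ≤ a)
    {G : ℝ → ℝ → ℝ} (hG : Continuous fun p : ℝ × ℝ => G p.1 p.2) {L : NNReal}
    (hlip : ∀ r, LipschitzWith L (G r)) (hLa : a * L < 1) :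
    ∃ y : ℝ → ℝ, Continuous y ∧
      ∀ r ∈ Icc 0 a, y r = r * ∫ s in (0 : ℝ)..1, s ^ k * G (r * s) (y (r * s)) := by
  have h_int : ∀ (y : C(Icc 0 a, ℝ)) (r : ℝ),
      Continuous fun s : ℝ => s ^ k * G (r * s) (IccExtend ha y (r * s)) := by
    intro y r
    have hy : Continuous (IccExtend ha y) := y.continuous.Icc_extend'
    exact (Real.continuous_rpow_const hk).mul
      (hG.comp (Continuous.prodMk (by fun_prop) (hy.comp (by fun_prop))))
  let Φ : C(Icc 0 a, ℝ) → C(Icc 0 a, ℝ) := fun y =>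
    { toFun := fun r =>
        r.1 * ∫ s in (0 : ℝ)..1, s ^ k * G (r.1 * s) (IccExtend ha y (r.1 * s))
      continuous_toFun := by
        have hy : Continuous (IccExtend ha y) := y.continuous.Icc_extend'
        refine continuous_subtype_val.mul
          (intervalIntegral.continuous_parametric_intervalIntegral_of_continuous' ?_ 0 1)
        exact ((Real.continuous_rpow_const hk).comp continuous_snd).mul
          (hG.comp (Continuous.prodMk (by fun_prop) (hy.comp (by fun_prop)))) }
  have hΦ : ContractingWith (⟨a, ha⟩ * L) Φ := by
    refine ⟨by exact_mod_cast hLa, LipschitzWith.of_dist_le_mul fun y z => ?_⟩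
    refine (ContinuousMap.dist_le (by positivity)).2 fun r => ?_
    change dist (r.1 * _) (r.1 * _) ≤ a * L * dist y z
    rw [Real.dist_eq, ← mul_sub, abs_mul, abs_of_nonneg r.2.1, mul_assoc,
      ← intervalIntegral.integral_sub ((h_int y r).intervalIntegrable 0 1)
        ((h_int z r).intervalIntegrable 0 1)]
    refine mul_le_mul r.2.2 ?_ (abs_nonneg _) ha
    have hbound := intervalIntegral.norm_integral_le_of_norm_le_const (a := (0 : ℝ)) (b := 1)
      (f := fun s : ℝ => s ^ k * G (r.1 * s) (IccExtend ha y (r.1 * s))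
        - s ^ k * G (r.1 * s) (IccExtend ha z (r.1 * s))) (C := L * dist y z) ?_
    · simpa using hbound
    · intro s hs
      rw [uIoc_of_le zero_le_one] at hs
      rw [← mul_sub, norm_mul, Real.norm_of_nonneg (Real.rpow_nonneg hs.1.le k), ← dist_eq_norm]
      calc s ^ k * dist (G (r.1 * s) (IccExtend ha y (r.1 * s)))
              (G (r.1 * s) (IccExtend ha z (r.1 * s)))
          ≤ 1 * (L * dist (IccExtend ha y (r.1 * s)) (IccExtend ha z (r.1 * s))) :=
            mul_le_mul (Real.rpow_le_one hs.1.le hs.2 hk) ((hlip _).dist_le_mul _ _)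
              dist_nonneg zero_le_one
        _ ≤ L * dist y z := by
            rw [one_mul]
            exact mul_le_mul_of_nonneg_left (ContinuousMap.dist_apply_le_dist _) L.2
  have : Nonempty (Icc 0 a) := ⟨⟨0, le_rfl, ha⟩⟩
  let y := hΦ.fixedPoint Φ
  have hy : Φ y = y := hΦ.fixedPoint_isFixedPt
  refine ⟨IccExtend ha y, y.continuous.Icc_extend', fun r hr => ?_⟩
  rw [IccExtend_of_mem ha y hr]
  exact (DFunLike.congr_fun hy ⟨r, hr⟩).symm

/-- For `k > 0` and `F` continuous on `[0,T] × ℝ` and Lipschitz in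
its second variable uniformly with respect to the first, the singular ODE
`y' + (k/r) y = F(r,y)` has, on some interval `[0,T']` with `0 < T' ≤ T`, a
unique continuous solution vanishing at `r = 0` and differentiable on `(0,T']`. -/
theorem singular_ode_existence_uniqueness
    (k T : ℝ) (hk : 0 < k) (hT : 0 < T) (F : ℝ → ℝ → ℝ)
    (hF_cont : ContinuousOn (fun p : ℝ × ℝ => F p.1 p.2) (Icc (0:ℝ) T ×ˢ univ))
    (L : NNReal) (hF_lip : ∀ r ∈ Icc (0:ℝ) T, LipschitzWith L (F r)) :
    ∃ T' : ℝ, T' ∈ Ioc (0:ℝ) T ∧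
      (∃ y : ℝ → ℝ, IsSingularODESolution k T' F y) ∧
      (∀ y₁ y₂ : ℝ → ℝ, IsSingularODESolution k T' F y₁ →
        IsSingularODESolution k T' F y₂ → ∀ r ∈ Icc (0:ℝ) T', y₁ r = y₂ r) := by
  let G : ℝ → ℝ → ℝ := fun r v => F (projIcc 0 T hT.le r) v
  have hG : Continuous fun p : ℝ × ℝ => G p.1 p.2 :=
    hF_cont.comp_continuous (f := fun p : ℝ × ℝ => ((projIcc 0 T hT.le p.1 : ℝ), p.2))
      ((continuous_subtype_val.comp (continuous_projIcc.comp continuous_fst)).prodMk continuous_snd)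
      fun p => ⟨(projIcc 0 T hT.le p.1).2, mem_univ _⟩
  have hG_eq : ∀ r ∈ Icc 0 T, G r = F r := fun r hr => by
    simp only [G, projIcc_of_mem hT.le hr]
  have hL : (0 : ℝ) < L + 1 := by positivity
  obtain ⟨a, ha, haT, hLa⟩ : ∃ a : ℝ, 0 < a ∧ a ≤ T ∧ a * L < 1 := by
    refine ⟨min T (1 / (L + 1)), lt_min hT (by positivity), min_le_left _ _, ?_⟩
    calc min T (1 / ((L : ℝ) + 1)) * L ≤ 1 / (L + 1) * L := by
          gcongr
          exact min_le_right _ _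
      _ < 1 := by
          rw [one_div_mul_eq_div, div_lt_one hL]
          exact lt_add_one _
  obtain ⟨y, hy_cont, hy⟩ := exists_continuous_eq_mul_integral_rpow hk.le ha.le hG
    (fun r => hF_lip _ (projIcc 0 T hT.le r).2) hLa
  refine ⟨a / 2, ⟨by linarith, by linarith⟩, ⟨y, hy_cont.continuousOn, ?_, ?_⟩, ?_⟩
  · rw [hy 0 ⟨le_rfl, ha.le⟩, zero_mul]
  · intro r hr
    have hra : r ∈ Ioo 0 a := ⟨hr.1, by linarith [hr.2]⟩
    have hd := (hasDerivAt_mul_integral_rpow_mul_comp hk.le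
      (hG.comp (continuous_id.prodMk hy_cont)) hr.1).congr_of_eventuallyEq
      ((eventually_mem_set.2 (Ioo_mem_nhds hra.1 hra.2)).mono
        fun x hx => hy x (Ioo_subset_Icc_self hx))
    refine hd.congr_deriv ?_
    change G r (y r) - k / r * (r * ∫ s in (0 : ℝ)..1, s ^ k * G (r * s) (y (r * s))) = _
    rw [← hy r (Ioo_subset_Icc_self hra), hG_eq r ⟨hr.1.le, by linarith [hra.2]⟩]
  · intro y₁ y₂ h₁ h₂
    exact h₁.eqOn hk.le (fun r hr => hF_lip r ⟨hr.1, by linarith [hr.2]⟩) h₂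
end
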